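/- Let 𝓑_b ≥ 0 and 𝓑_r ≥ 0 be budgets and define the strategy sets X = {x ∈ ℝ^V : x_j ≥ 0 for all j, Σ_{j∈V} x_j ≤ 𝓑_b} and Y = {y ∈ ℝ^V : y_j ≥ 0 for all j, Σ_{j∈V} y_j ≤ 𝓑_r}. Then the two-player zero-sum game on the conditional expected network exposure F admits a Nash equilibrium: there exist x* ∈ X and y* ∈ Y such that F(x*, y) ≤ F(x*, y*) ≤ F(x, y*) for all x ∈ X and all y ∈ Y. -/

import Mathlib

open Finset

noncomputable section

namespace Polya

variable {N : ℕ}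

/-- Closed neighborhood of node `i`. -/
def nbhd (G : SimpleGraph (Fin N)) [DecidableRel G.Adj] (i : Fin N) : Finset (Fin N) :=
  insert i (G.neighborFinset i)

/-- Conditional expected network exposure at the next time step, given red/black
super-urn counts `c i`, `d i` for each node, as a function of the curing
parameters `x` and infection parameters `y`. -/
def F (G : SimpleGraph (Fin N)) [DecidableRel G.Adj] (c d : Fin N → ℝ)
    (x y : Fin N → ℝ) : ℝ :=
  ∑ z : Fin N → Bool,
    (∏ i : Fin N, if z i then c i / (c i + d i) else 1 - c i / (c i + d i)) *
      ((1 / (N : ℝ)) * ∑ i : Fin N,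
        (c i + ∑ j ∈ nbhd G i, if z j then y j else 0) /
          (c i + d i + ∑ j ∈ nbhd G i, if z j then y j else x j))

theorem inv_conv {p u v a b : ℝ} (hp : 0 ≤ p) (hu : 0 < u) (hv : 0 < v) (ha : 0 ≤ a) (hb : 0 ≤ b)
    (hab : a + b = 1) : p / (a * u + b * v) ≤ a * (p / u) + b * (p / v) := by
  have h := (convexOn_zpow (𝕜 := ℝ) (-1)).2 (x := u) hu (y := v) hv ha hb hab
  simp only [smul_eq_mul, zpow_neg, zpow_one] at h
  simp only [div_eq_mul_inv]
  nlinarith [mul_le_mul_of_nonneg_left h hp]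

theorem frac_conc {e n m a b : ℝ} (he : 0 ≤ e) (hu : 0 < n + e) (hv : 0 < m + e)
    (ha : 0 ≤ a) (hb : 0 ≤ b) (hab : a + b = 1) :
    a * (n / (n + e)) + b * (m / (m + e)) ≤
      (a * n + b * m) / (a * (n + e) + b * (m + e)) := by
  have h := inv_conv he hu hv ha hb hab
  have hpos : 0 < a * (n + e) + b * (m + e) := by
    rcases ha.eq_or_lt with h0 | h0
    · have : b = 1 := by linarith
      subst this; subst h0; linarith
    · have := mul_pos h0 hu
      have := mul_nonneg hb hv.le
      linarith
  have h1 : n / (n + e) = 1 - e / (n + e) := by field_simp; ring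
  have h2 : m / (m + e) = 1 - e / (m + e) := by field_simp; ring
  have h3 : (a * n + b * m) / (a * (n + e) + b * (m + e))
      = 1 - e / (a * (n + e) + b * (m + e)) := by
    rw [eq_sub_iff_add_eq, ← add_div, div_eq_one_iff_eq hpos.ne']
    linear_combination (-e) * hab
  rw [h1, h2, h3]
  nlinarith

def S (B : ℝ) : Set (Fin N → ℝ) := {x : Fin N → ℝ | (∀ j, 0 ≤ x j) ∧ ∑ j, x j ≤ B}

theorem S_convex (B : ℝ) : Convex ℝ (S (N := N) B) := by
  intro x hx y hy a b ha hb hab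
  refine ⟨fun j => ?_, ?_⟩
  · have := mul_nonneg ha (hx.1 j)
    have := mul_nonneg hb (hy.1 j)
    simp only [Pi.add_apply, Pi.smul_apply, smul_eq_mul]
    linarith
  · simp only [Pi.add_apply, Pi.smul_apply, smul_eq_mul, Finset.sum_add_distrib, ← Finset.mul_sum]
    calc _ ≤ a * B + b * B :=
          add_le_add (mul_le_mul_of_nonneg_left hx.2 ha) (mul_le_mul_of_nonneg_left hy.2 hb)
      _ = B := by rw [← add_mul, hab, one_mul]

theorem S_compact (B : ℝ) : IsCompact (S (N := N) B) := by
  refine IsCompact.of_isClosed_subset (isCompact_Icc (a := (0 : Fin N → ℝ)) (b := fun _ => B)) ?_ ?_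
  · have : S (N := N) B = (⋂ j, {x | 0 ≤ x j}) ∩ {x | ∑ j, x j ≤ B} := by
      ext x; simp [S]
    rw [this]
    exact (isClosed_iInter fun j => isClosed_le continuous_const (continuous_apply j)).inter
      (isClosed_le (by fun_prop) continuous_const)
  · intro x hx
    exact ⟨hx.1, fun j => (Finset.single_le_sum (fun i _ => hx.1 i) (Finset.mem_univ j)).trans hx.2⟩

theorem S_nonempty {B : ℝ} (hB : 0 ≤ B) : (S (N := N) B).Nonempty :=
  ⟨0, by simp [S, hB]⟩

section
variable (G : SimpleGraph (Fin N)) [DecidableRel G.Adj] (c d : Fin N → ℝ)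

theorem den_pos (hcd : ∀ i, 0 < c i + d i) {x y : Fin N → ℝ} (hx : ∀ j, 0 ≤ x j)
    (hy : ∀ j, 0 ≤ y j) (z : Fin N → Bool) (i : Fin N) :
    0 < c i + d i + ∑ j ∈ nbhd G i, if z j then y j else x j := by
  have : 0 ≤ ∑ j ∈ nbhd G i, if z j then y j else x j :=
    Finset.sum_nonneg fun j _ => by split_ifs <;> simp [hx, hy]
  linarith [hcd i]

theorem w_nonneg (hc : ∀ i, 0 ≤ c i) (hd : ∀ i, 0 ≤ d i)
    (hcd : ∀ i, 0 < c i + d i) (z : Fin N → Bool) :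
    0 ≤ ∏ i : Fin N, if z i then c i / (c i + d i) else 1 - c i / (c i + d i) := by
  refine Finset.prod_nonneg fun i _ => ?_
  split_ifs
  · exact div_nonneg (hc i) (hcd i).le
  · rw [sub_nonneg, div_le_one (hcd i)]; linarith [hd i]

theorem ite_lin (s : Finset (Fin N)) (z : Fin N → Bool) {a b : ℝ} (x y x' y' : Fin N → ℝ) :
    (∑ j ∈ s, if z j then (a • y + b • y') j else (a • x + b • x') j) =
      a * (∑ j ∈ s, if z j then y j else x j) + b * (∑ j ∈ s, if z j then y' j else x' j) := by
  rw [Finset.mul_sum, Finset.mul_sum, ← Finset.sum_add_distrib]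
  refine Finset.sum_congr rfl fun j _ => ?_
  split_ifs <;> simp

theorem F_convex (hc : ∀ i, 0 ≤ c i) (hd : ∀ i, 0 ≤ d i)
    (hcd : ∀ i, 0 < c i + d i) (B : ℝ) {y : Fin N → ℝ} (hy : ∀ j, 0 ≤ y j) :
    ConvexOn ℝ (S B) (fun x => F G c d x y) := by
  refine ⟨S_convex B, fun x hx x' hx' a b ha hb hab => ?_⟩
  simp only [F, smul_eq_mul]
  rw [Finset.mul_sum, Finset.mul_sum, ← Finset.sum_add_distrib]
  refine Finset.sum_le_sum fun z _ => ?_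
  rw [mul_left_comm a, mul_left_comm b, ← mul_add]
  refine mul_le_mul_of_nonneg_left ?_ (w_nonneg c d hc hd hcd z)
  rw [mul_left_comm a, mul_left_comm b, ← mul_add]
  refine mul_le_mul_of_nonneg_left ?_ (by positivity)
  rw [Finset.mul_sum, Finset.mul_sum, ← Finset.sum_add_distrib]
  refine Finset.sum_le_sum fun i _ => ?_
  have hp : 0 ≤ c i + ∑ j ∈ nbhd G i, if z j then y j else 0 :=
    add_nonneg (hc i) (Finset.sum_nonneg fun j _ => by split_ifs <;> simp [hy])
  have h := inv_conv hp (den_pos G c d hcd hx.1 hy z i) (den_pos G c d hcd hx'.1 hy z i) ha hb hab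
  refine le_trans (le_of_eq ?_) h
  congr 1
  have hyy : y = a • y + b • y := by rw [← add_smul, hab, one_smul]
  have h2 := ite_lin (nbhd G i) z (a := a) (b := b) x y x' y
  rw [← hyy] at h2
  rw [h2]
  linear_combination -(c i + d i) * hab

theorem F_concave (hc : ∀ i, 0 ≤ c i) (hd : ∀ i, 0 ≤ d i)
    (hcd : ∀ i, 0 < c i + d i) (B : ℝ) {x : Fin N → ℝ} (hx : ∀ j, 0 ≤ x j) :
    ConcaveOn ℝ (S B) (fun y => F G c d x y) := by
  refine ⟨S_convex B, fun y hy y' hy' a b ha hb hab => ?_⟩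
  simp only [F, smul_eq_mul]
  rw [Finset.mul_sum, Finset.mul_sum, ← Finset.sum_add_distrib]
  refine Finset.sum_le_sum fun z _ => ?_
  rw [mul_left_comm a, mul_left_comm b, ← mul_add]
  refine mul_le_mul_of_nonneg_left ?_ (w_nonneg c d hc hd hcd z)
  rw [mul_left_comm a, mul_left_comm b, ← mul_add]
  refine mul_le_mul_of_nonneg_left ?_ (by positivity)
  rw [Finset.mul_sum, Finset.mul_sum, ← Finset.sum_add_distrib]
  refine Finset.sum_le_sum fun i _ => ?_
  have he : 0 ≤ d i + ∑ j ∈ nbhd G i, if z j then 0 else x j :=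
    add_nonneg (hd i) (Finset.sum_nonneg fun j _ => by split_ifs <;> simp [hx])
  have key : ∀ y : Fin N → ℝ, c i + d i + (∑ j ∈ nbhd G i, if z j then y j else x j) =
      (c i + ∑ j ∈ nbhd G i, if z j then y j else 0) +
        (d i + ∑ j ∈ nbhd G i, if z j then 0 else x j) := by
    intro y
    have : (∑ j ∈ nbhd G i, if z j then y j else x j) =
      (∑ j ∈ nbhd G i, if z j then y j else 0) + ∑ j ∈ nbhd G i, if z j then 0 else x j := by
      rw [← Finset.sum_add_distrib]
      refine Finset.sum_congr rfl fun j _ => ?_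
      split_ifs <;> simp
    rw [this]; ring
  have h1 := den_pos G c d hcd hx hy.1 z i
  have h2 := den_pos G c d hcd hx hy'.1 z i
  rw [key] at h1 h2
  have h := frac_conc he h1 h2 ha hb hab
  rw [key, key, key]
  refine le_trans h (le_of_eq ?_)
  have h3 := ite_lin (nbhd G i) z (a := a) (b := b) 0 y 0 y'
  simp only [smul_zero, add_zero, Pi.zero_apply] at h3
  rw [h3]
  congr 1
  · linear_combination c i * hab
  · linear_combination (c i + d i + ∑ j ∈ nbhd G i, if z j then 0 else x j) * hab

theorem F_cont (hcd : ∀ i, 0 < c i + d i) {T : Type*} [TopologicalSpace T] (s : Set T)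
    (f g : T → Fin N → ℝ) (hf : Continuous f) (hg : Continuous g)
    (hf0 : ∀ t ∈ s, ∀ j, 0 ≤ f t j) (hg0 : ∀ t ∈ s, ∀ j, 0 ≤ g t j) :
    ContinuousOn (fun t => F G c d (f t) (g t)) s := by
  unfold F
  refine continuousOn_finset_sum _ fun z _ => continuousOn_const.mul (continuousOn_const.mul
    (continuousOn_finset_sum _ fun i _ => ContinuousOn.div (Continuous.continuousOn ?_)
      (Continuous.continuousOn ?_) fun t ht =>
      (den_pos G c d hcd (hf0 t ht) (hg0 t ht) z i).ne'))
  · refine continuous_const.add (continuous_finset_sum _ fun j _ => ?_)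
    split_ifs <;> fun_prop
  · refine continuous_const.add (continuous_finset_sum _ fun j _ => ?_)
    split_ifs <;> fun_prop

end

/-- the two-player zero-sum game on the conditional expected
network exposure, with budget-constrained strategy sets, admits a Nash
equilibrium. -/
theorem F_nash_equilibrium (hN : 1 ≤ N)
    (G : SimpleGraph (Fin N)) [DecidableRel G.Adj]
    (c d : Fin N → ℝ) (hc : ∀ i, 0 ≤ c i) (hd : ∀ i, 0 ≤ d i)
    (hcd : ∀ i, 0 < c i + d i)
    (Bb Br : ℝ) (hBb : 0 ≤ Bb) (hBr : 0 ≤ Br) :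
    ∃ xstar ∈ {x : Fin N → ℝ | (∀ j, 0 ≤ x j) ∧ ∑ j, x j ≤ Bb},
      ∃ ystar ∈ {y : Fin N → ℝ | (∀ j, 0 ≤ y j) ∧ ∑ j, y j ≤ Br},
        (∀ y ∈ {y : Fin N → ℝ | (∀ j, 0 ≤ y j) ∧ ∑ j, y j ≤ Br},
          F G c d xstar y ≤ F G c d xstar ystar) ∧
        (∀ x ∈ {x : Fin N → ℝ | (∀ j, 0 ≤ x j) ∧ ∑ j, x j ≤ Bb},
          F G c d xstar ystar ≤ F G c d x ystar) := by
  obtain ⟨a, ha, b, hb, h⟩ := Sion.exists_isSaddlePointOn (f := F G c d)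
    (S_nonempty (N := N) hBb) (S_convex Bb) (S_compact Bb)
    (fun y hy => (F_cont G c d hcd (S Bb) id (fun _ => y) continuous_id continuous_const
      (fun t ht => ht.1) (fun _ _ => hy.1)).lowerSemicontinuousOn)
    (fun y hy => (F_convex G c d hc hd hcd Bb hy.1).quasiconvexOn)
    (S_convex Br) (S_nonempty (N := N) hBr) (S_compact Br)
    (fun x hx => (F_cont G c d hcd (S Br) (fun _ => x) id continuous_const continuous_id
      (fun _ _ => hx.1) (fun t ht => ht.1)).upperSemicontinuousOn)
    (fun x hx => (F_concave G c d hc hd hcd Br hx.1).quasiconcaveOn)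
  exact ⟨a, ha, b, hb, fun y hy => h a ha y hy, fun x hx => h x hx b hb⟩

end Polya
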